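/- arXiv:1404.7711 — 2 statements merged into one kernel-verified Lean document; each statement's English description precedes it below -/
import Mathlib

section
/- For every n > 3 and every failure probability p ∈ (0, 1 − 3/n), the single-cluster placement x^sgl, defined by x^sgl_i = 1/2 for all i ∈ {1,…,n}, is not optimal: there exists x ∈ [0,1]^n with C(x) < C(x^sgl). Consequently, the neighborhood of p = 1 on which x^sgl is optimal has length at most 3/n. -/
open Finset MeasureTheory

/-- Coverage cost on the line `[0,1]` for placement `x` and active set `A`:
the largest distance from a point of `[0,1]` to the closest active sensor
(`1` by convention if `A = ∅`). -/
noncomputable def cost0 {n : ℕ} (x : Fin n → ℝ) (A : Finset (Fin n)) : ℝ :=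
  if A.Nonempty then ⨆ s : Set.Icc (0:ℝ) 1, ⨅ j : A, |s.1 - x j.1| else 1

/-- Probability that `A` is the active set, under independent failures with
probability `p`. -/
noncomputable def prob {n : ℕ} (p : ℝ) (A : Finset (Fin n)) : ℝ :=
  p ^ (n - A.card) * (1 - p) ^ A.card

/-- Expected coverage cost `C(x)` under independent failures with probability `p`. -/
noncomputable def expCost {n : ℕ} (p : ℝ) (x : Fin n → ℝ) : ℝ :=
  ∑ A : Finset (Fin n), prob p A * cost0 x A

/-- The equispaced placement `x^eq`, whose `i`-th entry (`i = 0, …, n-1`) is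
`(2i+1)/(2n)`. -/
noncomputable def xeq (n : ℕ) : Fin n → ℝ := fun i => (2 * (i : ℝ) + 1) / (2 * n)

/-- The `k`-th smallest element of the finite set `A` (0-based). -/
noncomputable def nth {n : ℕ} (A : Finset (Fin n)) (k : Fin A.card) : Fin n :=
  (A.orderIsoOfFin rfl k).1

/-- Coverage cost on the circle of circumference 1 for the active set `A`. -/
noncomputable def ccost0 {n : ℕ} (x : Fin n → ℝ) (A : Finset (Fin n)) : ℝ :=
  if A.Nonempty then
    ⨆ s : Set.Icc (0:ℝ) 1, ⨅ j : A, min |s.1 - x j.1| (1 - |s.1 - x j.1|)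
  else 1

/-- Expected circle coverage cost `C̃(x)`. -/
noncomputable def cExpCost {n : ℕ} (p : ℝ) (x : Fin n → ℝ) : ℝ :=
  ∑ A : Finset (Fin n), prob p A * ccost0 x A

/-- Harmonic number `H_m = ∑_{h=1}^m 1/h`. -/
noncomputable def H (m : ℕ) : ℝ := ∑ i ∈ Finset.range m, 1 / ((i : ℝ) + 1)

/-- Length of the longest run of consecutive indices of `{0, …, n-1}` not
belonging to `A`. -/
noncomputable def longestRun {n : ℕ} (A : Finset (Fin n)) : ℕ :=
  sSup {r : ℕ | ∃ a : ℕ, a + r ≤ n ∧ ∀ i : Fin n, a ≤ i.1 → i.1 < a + r → i ∉ A}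

/-- Expected cost in the Cortés (constant-number-of-failures) model where
exactly `k` sensors fail, uniformly at random. -/
noncomputable def cortesCost {n : ℕ} (k : ℕ) (x : Fin n → ℝ) : ℝ :=
  (n.choose k : ℝ)⁻¹ *
    ∑ A ∈ Finset.univ.filter (fun A : Finset (Fin n) => A.card = n - k), cost0 x A

/-- Expectation over the random uniform i.i.d. placement `x^rand ∈ [0,1]^n`
of the expected cost `C(x^rand)`. -/
noncomputable def randExp (n : ℕ) (p : ℝ) : ℝ :=
  ∫ x in Set.univ.pi (fun _ : Fin n => Set.Icc (0:ℝ) 1), expCost p x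

/-- `E[C_0(x^{rand,m})]`: expected coverage cost of `m` i.i.d. uniform sensors,
all active. -/
noncomputable def randCost0 (m : ℕ) : ℝ :=
  ∫ x in Set.univ.pi (fun _ : Fin m => Set.Icc (0:ℝ) 1), cost0 x Finset.univ

/-- `E[C^{k,n}(x^rand)]`: expectation over the random placement of the Cortés
model cost. -/
noncomputable def randCortes (n k : ℕ) : ℝ :=
  ∫ x in Set.univ.pi (fun _ : Fin n => Set.Icc (0:ℝ) 1), cortesCost k x

/-- The probability that every sensor of `S` fails is `p ^ #S`. -/
lemma sum_prob_disjoint {n : ℕ} (p : ℝ) (S : Finset (Fin n)) :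
    ∑ A : Finset (Fin n), prob p A * (if Disjoint A S then 1 else 0) = p ^ #S := by
  have hfilter : (univ.filter fun A : Finset (Fin n) => Disjoint A S) = Sᶜ.powerset := by
    ext A
    simp [Finset.subset_compl_iff_disjoint_right]
  have hcard : #S + #Sᶜ = n := by simp
  simp only [mul_ite, mul_one, mul_zero]
  rw [← Finset.sum_filter, hfilter]
  calc ∑ A ∈ Sᶜ.powerset, prob p A
      = ∑ A ∈ Sᶜ.powerset, p ^ #S * ((1 - p) ^ #A * p ^ (#Sᶜ - #A)) := by
        refine Finset.sum_congr rfl fun A hA => ?_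
        have hle := Finset.card_le_card (Finset.mem_powerset.1 hA)
        rw [prob, show n - #A = #S + (#Sᶜ - #A) by omega, pow_add]
        ring
    _ = p ^ #S := by
        rw [← Finset.mul_sum, Finset.sum_pow_mul_eq_add_pow]
        simp

lemma prob_nonneg {n : ℕ} {p : ℝ} (hp0 : 0 ≤ p) (hp1 : p ≤ 1) (A : Finset (Fin n)) :
    0 ≤ prob p A :=
  mul_nonneg (pow_nonneg hp0 _) (pow_nonneg (sub_nonneg.2 hp1) _)

/-- If every point of `[0,1]` is within distance `c` of an active sensor, the cost is at most `c`. -/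
lemma cost0_le {n : ℕ} {x : Fin n → ℝ} {A : Finset (Fin n)} (hA : A.Nonempty) {c : ℝ}
    (h : ∀ s ∈ Set.Icc (0:ℝ) 1, ∃ j ∈ A, |s - x j| ≤ c) : cost0 x A ≤ c := by
  rw [cost0, if_pos hA]
  have : Nonempty (Set.Icc (0:ℝ) 1) := ⟨⟨0, by simp⟩⟩
  refine ciSup_le fun s => ?_
  obtain ⟨j, hj, hc⟩ := h s.1 s.2
  refine le_trans (ciInf_le ⟨0, ?_⟩ (⟨j, hj⟩ : A)) hc
  rintro _ ⟨i, rfl⟩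
  exact abs_nonneg _

lemma cost0_half {n : ℕ} {A : Finset (Fin n)} (hA : A.Nonempty) :
    cost0 (fun _ => (1:ℝ) / 2) A = 1 / 2 := by
  rw [cost0, if_pos hA]
  have : Nonempty A := hA.to_subtype
  have : Nonempty (Set.Icc (0:ℝ) 1) := ⟨⟨0, by simp⟩⟩
  simp only [ciInf_const]
  have hbound (s : Set.Icc (0:ℝ) 1) : |s.1 - 1 / 2| ≤ 1 / 2 := by
    obtain ⟨s, h0, h1⟩ := s
    rw [abs_le]
    constructor <;> linarith
  refine le_antisymm (ciSup_le hbound) ?_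
  refine le_trans ?_ (le_ciSup ⟨1 / 2, ?_⟩ (⟨0, by simp⟩ : Set.Icc (0:ℝ) 1))
  · norm_num
  · rintro _ ⟨s, rfl⟩
    exact hbound s

/-- The placement with the sensors of `L` at `1/4` and all other sensors at `3/4`. -/
noncomputable def twoCluster {n : ℕ} (L : Finset (Fin n)) : Fin n → ℝ :=
  fun i => if i ∈ L then 1 / 4 else 3 / 4

lemma twoCluster_mem_Icc {n : ℕ} (L : Finset (Fin n)) (i : Fin n) :
    twoCluster L i ∈ Set.Icc (0:ℝ) 1 := by
  unfold twoCluster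
  split_ifs <;> norm_num

/-- Pointwise comparison of a two-cluster placement with the single cluster. -/
lemma cost0_twoCluster_le {n : ℕ} (L A : Finset (Fin n)) :
    cost0 (twoCluster L) A ≤ cost0 (fun _ => (1:ℝ) / 2) A +
      1 / 4 * (-(if Disjoint A ∅ then 1 else 0) + 2 * (if Disjoint A L then 1 else 0)
        + 2 * (if Disjoint A Lᶜ then 1 else 0) - 3 * (if Disjoint A univ then 1 else 0)) := by
  rcases A.eq_empty_or_nonempty with rfl | hA
  · simp [cost0]
    norm_num
  rw [cost0_half hA, if_pos (Finset.disjoint_empty_right A), if_neg (c := Disjoint A univ)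
    (by simpa [Finset.disjoint_iff_inter_eq_empty] using hA.ne_empty)]
  have hfar : cost0 (twoCluster L) A ≤ 3 / 4 := by
    refine cost0_le hA fun s hs => ?_
    obtain ⟨j, hj⟩ := hA
    refine ⟨j, hj, ?_⟩
    obtain ⟨h0, h1⟩ := hs
    unfold twoCluster
    split_ifs <;> rw [abs_le] <;> constructor <;> linarith
  by_cases hL : Disjoint A L
  · rw [if_pos hL]
    split_ifs <;> linarith
  by_cases hR : Disjoint A Lᶜ
  · rw [if_pos hR, if_neg hL]
    linarith
  rw [if_neg hL, if_neg hR]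
  obtain ⟨i, hiA, hiL⟩ := Finset.not_disjoint_iff.1 hL
  obtain ⟨j, hjA, hjL⟩ := Finset.not_disjoint_iff.1 hR
  rw [Finset.mem_compl] at hjL
  have hnear : cost0 (twoCluster L) A ≤ 1 / 4 := by
    refine cost0_le hA fun s ⟨h0, h1⟩ => ?_
    rcases le_total s (1 / 2) with h | h
    · refine ⟨i, hiA, ?_⟩
      rw [twoCluster, if_pos hiL, abs_le]
      constructor <;> linarith
    · refine ⟨j, hjA, ?_⟩
      rw [twoCluster, if_neg hjL, abs_le]
      constructor <;> linarith
  linarith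

lemma expCost_twoCluster_le {n : ℕ} {p : ℝ} (hp0 : 0 ≤ p) (hp1 : p ≤ 1) (L : Finset (Fin n)) :
    expCost p (twoCluster L) ≤ expCost p (fun _ : Fin n => (1:ℝ) / 2) +
      1 / 4 * (-1 + 2 * p ^ #L + 2 * p ^ #Lᶜ - 3 * p ^ n) := by
  have hempty := sum_prob_disjoint p (∅ : Finset (Fin n))
  have huniv := sum_prob_disjoint p (univ : Finset (Fin n))
  rw [Finset.card_empty, pow_zero] at hempty
  rw [Finset.card_univ, Fintype.card_fin] at huniv
  refine (Finset.sum_le_sum fun A _ => mul_le_mul_of_nonneg_left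
    (cost0_twoCluster_le L A) (prob_nonneg hp0 hp1 A)).trans_eq ?_
  rw [← sum_prob_disjoint p L, ← sum_prob_disjoint p Lᶜ, ← huniv,
    show (-1 : ℝ) = -∑ A : Finset (Fin n), prob p A * (if Disjoint A ∅ then 1 else 0) by rw [hempty],
    expCost]
  simp only [← Finset.sum_neg_distrib, Finset.mul_sum, ← Finset.sum_add_distrib,
    ← Finset.sum_sub_distrib]
  exact Finset.sum_congr rfl fun A _ => by ring

/-- Second-order Bernoulli inequality. -/
lemma one_add_pow_ge_quadratic {u : ℝ} (hu : 0 ≤ u) (k : ℕ) :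
    1 + k * u + k * (k - 1) / 2 * u ^ 2 ≤ (1 + u) ^ k := by
  induction k with
  | zero => simp
  | succ k ih =>
    have hk : (0:ℝ) ≤ k * (k - 1) := by
      rcases k with _ | k
      · simp
      · push_cast
        have : (0:ℝ) ≤ k := k.cast_nonneg
        nlinarith
    have h := mul_le_mul_of_nonneg_right ih (by linarith : 0 ≤ 1 + u)
    have h3 : 0 ≤ (k * (k - 1) : ℝ) * u ^ 3 := mul_nonneg hk (pow_nonneg hu 3)
    rw [pow_succ (1 + u)]
    push_cast
    linarith

lemma pow_half_lt_third {n : ℕ} (hn : 3 < n) {p : ℝ} (hp0 : 0 < p) (hp1 : p < 1 - 3 / n) :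
    p ^ (n / 2) < 1 / 3 := by
  obtain ⟨m, hm⟩ : ∃ m, n / 2 = m + 2 := ⟨n / 2 - 2, by omega⟩
  have hnm : (n : ℝ) ≤ 2 * m + 5 := by
    exact_mod_cast (by omega : n ≤ 2 * m + 5)
  have hm0 : (0:ℝ) ≤ m := m.cast_nonneg
  have hnpos : (0:ℝ) < n := by exact_mod_cast (by omega : 0 < n)
  set u : ℝ := 3 / (2 * (m + 1)) with hu
  have hu0 : 0 < u := by positivity
  have hmu : (m + 1) * u = 3 / 2 := by
    rw [hu]
    field_simp
  have hpu : p * (1 + u) ≤ 1 := by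
    have h1 : 3 / (2 * m + 5 : ℝ) ≤ 3 / n := by gcongr
    have h2 : p ≤ 1 - 3 / (2 * m + 5 : ℝ) := by linarith
    calc p * (1 + u) ≤ (1 - 3 / (2 * m + 5 : ℝ)) * (1 + u) := by gcongr
      _ = 1 := by
        rw [hu]
        field_simp
        ring
  have hpow : 3 < (1 + u) ^ (m + 2) := by
    refine lt_of_lt_of_le ?_ (one_add_pow_ge_quadratic hu0.le (m + 2))
    push_cast
    nlinarith
  have hmul : p ^ (m + 2) * (1 + u) ^ (m + 2) ≤ 1 := by
    rw [← mul_pow]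
    exact pow_le_one₀ (by positivity) hpu
  have hppos : 0 < p ^ (m + 2) := pow_pos hp0 _
  rw [hm]
  nlinarith

/-- for `n > 3` and any failure probability `p < 1 - 3/n`, the
single-cluster placement `x^sgl_i = 1/2` is not optimal: some placement in
`[0,1]^n` has strictly smaller expected cost. Hence the neighborhood of
`p = 1` where `x^sgl` is optimal has length at most `3/n`. -/
theorem xsgl_not_optimal {n : ℕ} (hn : 3 < n) (p : ℝ) (hp0 : 0 < p)
    (hp1 : p < 1 - 3 / n) :
    ∃ x : Fin n → ℝ, (∀ i, x i ∈ Set.Icc (0:ℝ) 1) ∧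
      expCost p x < expCost p (fun _ : Fin n => (1:ℝ)/2) := by
  have hk := pow_half_lt_third hn hp0 hp1
  have hp : p ≤ 1 := by
    have : (0:ℝ) ≤ 3 / n := by positivity
    linarith
  obtain ⟨L, -, hL⟩ := Finset.exists_subset_card_eq (s := (univ : Finset (Fin n)))
    (n := n / 2) (by simpa using Nat.div_le_self n 2)
  refine ⟨twoCluster L, twoCluster_mem_Icc L, ?_⟩
  have hcard : #Lᶜ = n - n / 2 := by rw [Finset.card_compl, Fintype.card_fin, hL]
  have hle : p ^ (n - n / 2) ≤ p ^ (n / 2) := pow_le_pow_of_le_one hp0.le hp (by omega)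
  have hprod : p ^ n = p ^ (n / 2) * p ^ (n - n / 2) := by
    rw [← pow_add]
    congr 1
    omega
  have h := expCost_twoCluster_le hp0.le hp L
  rw [hcard, hL, hprod] at h
  have hb : 0 < p ^ (n - n / 2) := pow_pos hp0 _
  nlinarith
end

section
/- Fix p ∈ (0,1). There exist a constant M > 0 and n_0 ∈ ℕ such that for all n ≥ n_0, |E[C(x^rand)] − (1/(2(1−p))) · (log n)/n| ≤ M/n; that is, E[C(x^rand)] = (1/(2(1−p))) (log n)/n + O(1/n) as n → ∞. -/
open Finset MeasureTheory

/-- The cube of admissible placements. -/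
def cube (n : ℕ) : Set (Fin n → ℝ) := Set.univ.pi fun _ => Set.Icc (0:ℝ) 1

lemma mem_cube {n : ℕ} {x : Fin n → ℝ} : x ∈ cube n ↔ ∀ i, x i ∈ Set.Icc (0:ℝ) 1 := by
  simp only [cube, Set.mem_univ_pi]

lemma measurableSet_cube (n : ℕ) : MeasurableSet (cube n) :=
  MeasurableSet.univ_pi fun _ => measurableSet_Icc

lemma volume_restrict_cube (n : ℕ) : (volume : Measure (Fin n → ℝ)).restrict (cube n) =
    Measure.pi fun _ => (volume : Measure ℝ).restrict (Set.Icc 0 1) := by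
  rw [cube, volume_pi, Measure.restrict_pi_pi]

instance isProbabilityMeasure_restrict_Icc_zero_one :
    IsProbabilityMeasure ((volume : Measure ℝ).restrict (Set.Icc 0 1)) :=
  ⟨by simp⟩

instance isProbabilityMeasure_restrict_cube (n : ℕ) :
    IsProbabilityMeasure ((volume : Measure (Fin n → ℝ)).restrict (cube n)) := by
  rw [volume_restrict_cube]; infer_instance

lemma bddBelow_range_dist {n : ℕ} (x : Fin n → ℝ) (A : Finset (Fin n)) (s : ℝ) :
    BddBelow (Set.range fun j : A => |s - x j.1|) :=
  ⟨0, by rintro _ ⟨j, rfl⟩; positivity⟩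

lemma bddAbove_range_iInf_dist {n : ℕ} (x : Fin n → ℝ) {A : Finset (Fin n)} (hA : A.Nonempty) :
    BddAbove (Set.range fun s : Set.Icc (0:ℝ) 1 => ⨅ j : A, |s.1 - x j.1|) := by
  obtain ⟨j, hj⟩ := hA
  refine ⟨1 + |x j|, ?_⟩
  rintro _ ⟨s, rfl⟩
  refine (ciInf_le (bddBelow_range_dist x A s.1) ⟨j, hj⟩).trans ((abs_sub _ _).trans ?_)
  gcongr
  exact abs_le.2 ⟨by linarith [s.2.1], s.2.2⟩

lemma measurable_cost0 {n : ℕ} (A : Finset (Fin n)) :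
    Measurable fun x : Fin n → ℝ => cost0 x A := by
  by_cases hA : A.Nonempty
  · simp only [cost0, if_pos hA]
    have : Nonempty A := hA.to_subtype
    refine LowerSemicontinuous.measurable
      (lowerSemicontinuous_ciSup (fun x => bddAbove_range_iInf_dist x hA) fun s => ?_)
    refine Continuous.lowerSemicontinuous ?_
    simp only [← Finset.inf'_univ_eq_ciInf]
    exact Continuous.finset_inf'_apply _ fun j _ => by fun_prop
  · simp only [cost0, if_neg hA]
    exact measurable_const

lemma exists_forall_lt_of_lt_cost0 {n : ℕ} {x : Fin n → ℝ} {A : Finset (Fin n)} {t : ℝ}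
    (h : t < cost0 x A) : ∃ s ∈ Set.Icc (0:ℝ) 1, ∀ j ∈ A, t < |s - x j| := by
  by_cases hA : A.Nonempty
  · rw [cost0, if_pos hA] at h
    obtain ⟨s, hs⟩ := exists_lt_of_lt_ciSup h
    exact ⟨s, s.2, fun j hj => hs.trans_le (ciInf_le (bddBelow_range_dist x A s.1) ⟨j, hj⟩)⟩
  · rw [Finset.not_nonempty_iff_eq_empty] at hA
    exact ⟨0, by simp, by simp [hA]⟩

lemma le_cost0 {n : ℕ} {x : Fin n → ℝ} {A : Finset (Fin n)} {s t : ℝ} (ht : t ≤ 1)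
    (hs : s ∈ Set.Icc (0:ℝ) 1) (h : ∀ j ∈ A, t ≤ |s - x j|) : t ≤ cost0 x A := by
  by_cases hA : A.Nonempty
  · have : Nonempty A := hA.to_subtype
    rw [cost0, if_pos hA]
    exact (le_ciInf fun j : A => h j.1 j.2).trans
      (le_ciSup (bddAbove_range_iInf_dist x hA) (⟨s, hs⟩ : Set.Icc (0:ℝ) 1))
  · rwa [cost0, if_neg hA]

lemma cost0_nonneg {n : ℕ} (x : Fin n → ℝ) (A : Finset (Fin n)) : 0 ≤ cost0 x A :=
  le_cost0 zero_le_one (s := 0) (by simp) fun _ _ => abs_nonneg _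

lemma cost0_le_one {n : ℕ} {x : Fin n → ℝ} (hx : x ∈ cube n) (A : Finset (Fin n)) :
    cost0 x A ≤ 1 := by
  by_contra! h
  by_cases hA : A.Nonempty
  · obtain ⟨s, hs, hj⟩ := exists_forall_lt_of_lt_cost0 h
    obtain ⟨j, hjA⟩ := hA
    have := hj j hjA
    have hxj := mem_cube.1 hx j
    exact this.not_ge (abs_le.2 ⟨by linarith [hs.1, hxj.2], by linarith [hs.2, hxj.1]⟩)
  · simp [cost0, if_neg hA] at h

lemma integrableOn_cost0 {n : ℕ} (A : Finset (Fin n)) :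
    IntegrableOn (fun x : Fin n → ℝ => cost0 x A) (cube n) := by
  refine Integrable.of_bound (measurable_cost0 A).aestronglyMeasurable 1 ?_
  filter_upwards [ae_restrict_mem (measurableSet_cube n)] with x hx
  rw [Real.norm_of_nonneg (cost0_nonneg x A)]
  exact cost0_le_one hx A

/-- Indicator that no active sensor lies in a cell `[i/n, (i+1)/n)` with `i ∈ S`. -/
noncomputable def void {n : ℕ} (S : Finset ℕ) (x : Fin n → ℝ) (A : Finset (Fin n)) : ℝ :=
  if ∀ j ∈ A, ⌊(n:ℝ) * x j⌋₊ ∉ S then 1 else 0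

lemma void_nonneg {n : ℕ} (S : Finset ℕ) (x : Fin n → ℝ) (A : Finset (Fin n)) :
    0 ≤ void S x A := by
  unfold void; split_ifs <;> norm_num

lemma void_le_one {n : ℕ} (S : Finset ℕ) (x : Fin n → ℝ) (A : Finset (Fin n)) :
    void S x A ≤ 1 := by
  unfold void; split_ifs <;> norm_num

lemma void_mul_void {n : ℕ} (S T : Finset ℕ) (x : Fin n → ℝ) (A : Finset (Fin n)) :
    void S x A * void T x A = void (S ∪ T) x A := by
  simp only [void, Finset.mem_union, not_or, forall_and]
  split_ifs <;> simp_all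

lemma void_eq_prod {n : ℕ} (S : Finset ℕ) (x : Fin n → ℝ) (A : Finset (Fin n)) :
    void S x A =
      ∏ j, if j ∈ A then (if ⌊(n:ℝ) * x j⌋₊ ∈ S then (0:ℝ) else 1) else 1 := by
  rw [Finset.prod_ite_mem, Finset.univ_inter, void]
  split_ifs with h
  · exact (Finset.prod_eq_one fun j hj => if_neg (h j hj)).symm
  · push Not at h
    obtain ⟨j, hj, hS⟩ := h
    rw [Finset.prod_eq_zero hj (by rw [if_pos hS])]

lemma measurable_void {n : ℕ} (S : Finset ℕ) (A : Finset (Fin n)) :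
    Measurable fun x : Fin n → ℝ => void S x A := by
  simp only [void_eq_prod]
  refine Finset.measurable_prod _ fun j _ => ?_
  by_cases hj : j ∈ A
  · simp only [if_pos hj]
    refine Measurable.ite ?_ measurable_const measurable_const
    exact (Nat.measurable_floor.comp ((measurable_pi_apply j).const_mul _))
      S.measurableSet
  · simp only [if_neg hj]
    exact measurable_const

lemma integrableOn_void {n : ℕ} (S : Finset ℕ) (A : Finset (Fin n)) :
    IntegrableOn (fun x : Fin n → ℝ => void S x A) (cube n) := by
  refine Integrable.of_bound (measurable_void S A).aestronglyMeasurable 1 (.of_forall fun x => ?_)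
  rw [Real.norm_of_nonneg (void_nonneg S x A)]
  exact void_le_one S x A

lemma floor_mul_eq_iff {n i : ℕ} (hn : 0 < n) {x : ℝ} (hx : 0 ≤ x) :
    ⌊(n:ℝ) * x⌋₊ = i ↔ x ∈ Set.Ico ((i:ℝ) / n) ((i + 1) / n) := by
  have hn' : (0:ℝ) < n := by exact_mod_cast hn
  rw [Nat.floor_eq_iff (by positivity), Set.mem_Ico, div_le_iff₀ hn', lt_div_iff₀ hn',
    mul_comm x]

lemma volume_floor_mul_eq {n i : ℕ} (hi : i < n) :
    (volume.restrict (Set.Icc (0:ℝ) 1)).real {x | ⌊(n:ℝ) * x⌋₊ = i} = 1 / n := by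
  have hn : 0 < n := by omega
  have hn' : (0:ℝ) < n := by exact_mod_cast hn
  have hi' : (i:ℝ) + 1 ≤ n := by exact_mod_cast hi
  have : {x | ⌊(n:ℝ) * x⌋₊ = i} ∩ Set.Icc (0:ℝ) 1 = Set.Ico ((i:ℝ) / n) ((i + 1) / n) := by
    ext x
    constructor
    · rintro ⟨h, h0, -⟩
      exact (floor_mul_eq_iff hn h0).1 h
    · intro h
      have h0 : 0 ≤ x := le_trans (by positivity) h.1
      exact ⟨(floor_mul_eq_iff hn h0).2 h, h0, h.2.le.trans ((div_le_one hn').2 hi')⟩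
  rw [measureReal_restrict_apply' measurableSet_Icc, this,
    Real.volume_real_Ico_of_le (by gcongr; linarith)]
  ring

lemma integral_ite_floor_mem {n : ℕ} {S : Finset ℕ} (hS : S ⊆ Finset.range n) :
    ∫ x in Set.Icc (0:ℝ) 1, (if ⌊(n:ℝ) * x⌋₊ ∈ S then (0:ℝ) else 1) = 1 - #S / n := by
  have hmeas (i : ℕ) : MeasurableSet {x : ℝ | ⌊(n:ℝ) * x⌋₊ = i} :=
    (Nat.measurable_floor.comp (measurable_id.const_mul (n:ℝ))) (measurableSet_singleton i)
  have hint (i : ℕ) : Integrable (Set.indicator {x : ℝ | ⌊(n:ℝ) * x⌋₊ = i} fun _ => (1:ℝ))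
      (volume.restrict (Set.Icc (0:ℝ) 1)) :=
    (integrable_const 1).indicator (hmeas i)
  have h (x : ℝ) : (if ⌊(n:ℝ) * x⌋₊ ∈ S then (0:ℝ) else 1) =
      1 - ∑ i ∈ S, Set.indicator {x : ℝ | ⌊(n:ℝ) * x⌋₊ = i} (fun _ => (1:ℝ)) x := by
    simp only [Set.indicator_apply, Set.mem_ofPred_eq, Finset.sum_ite_eq]
    split_ifs <;> norm_num
  simp only [h]
  rw [integral_sub (integrable_const _) (integrable_finsetSum _ fun i _ => hint i),
    integral_finsetSum _ fun i _ => hint i]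
  have h1 : ∀ i ∈ S, ∫ x in Set.Icc (0:ℝ) 1,
      Set.indicator {x : ℝ | ⌊(n:ℝ) * x⌋₊ = i} (fun _ => (1:ℝ)) x = 1 / n := fun i hi => by
    rw [integral_indicator_const _ (hmeas i), volume_floor_mul_eq (Finset.mem_range.1 (hS hi))]
    simp
  rw [Finset.sum_congr rfl h1]
  simp [div_eq_mul_inv]

lemma integral_void {n : ℕ} {S : Finset ℕ} (hS : S ⊆ Finset.range n) (A : Finset (Fin n)) :
    ∫ x in cube n, void S x A = (1 - #S / n : ℝ) ^ #A := by
  simp only [void_eq_prod]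
  rw [volume_restrict_cube, integral_fintype_prod_eq_prod (fun (j : Fin n) (y : ℝ) =>
    if j ∈ A then (if ⌊(n:ℝ) * y⌋₊ ∈ S then (0:ℝ) else 1) else 1)]
  have h (j : Fin n) : ∫ y in Set.Icc (0:ℝ) 1,
      (if j ∈ A then (if ⌊(n:ℝ) * y⌋₊ ∈ S then (0:ℝ) else 1) else 1) =
      if j ∈ A then (1 - #S / n : ℝ) else 1 := by
    split_ifs
    · exact integral_ite_floor_mem hS
    · simp
  simp only [h, Finset.prod_ite_mem, Finset.univ_inter, Finset.prod_const]

/-- Expectation over the uniform placement and the random active set. -/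
noncomputable def sensorMean {n : ℕ} (p : ℝ) (f : (Fin n → ℝ) → Finset (Fin n) → ℝ) : ℝ :=
  ∑ A, prob p A * ∫ x in cube n, f x A

lemma randExp_eq_sensorMean (n : ℕ) (p : ℝ) : randExp n p = sensorMean p (cost0 (n := n)) := by
  unfold randExp sensorMean expCost
  rw [← cube, integral_finsetSum _ fun A _ => (integrableOn_cost0 A).const_mul _]
  simp only [integral_const_mul]

lemma sum_prob_mul_pow (n : ℕ) (p z : ℝ) :
    ∑ A : Finset (Fin n), prob p A * z ^ #A = (p + (1 - p) * z) ^ n := by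
  rw [add_comm, ← Fin.sum_pow_mul_eq_add_pow]
  refine Finset.sum_congr rfl fun A _ => ?_
  rw [prob, mul_pow]
  ring

lemma sensorMean_void {n : ℕ} (p : ℝ) {S : Finset ℕ} (hS : S ⊆ Finset.range n) :
    sensorMean p (void (n := n) S) = (1 - (1 - p) * (#S / n)) ^ n := by
  simp only [sensorMean, integral_void hS, sum_prob_mul_pow]
  congr 1
  ring

lemma sensorMean_const (n : ℕ) (p c : ℝ) : sensorMean (n := n) p (fun _ _ => c) = c := by
  have := sum_prob_mul_pow n p 1
  simp only [one_pow, mul_one, add_sub_cancel] at this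
  simp [sensorMean, ← Finset.sum_mul, this]

lemma sensorMean_mul_left {n : ℕ} (p c : ℝ) (f : (Fin n → ℝ) → Finset (Fin n) → ℝ) :
    sensorMean p (fun x A => c * f x A) = c * sensorMean p f := by
  simp only [sensorMean, integral_const_mul, Finset.mul_sum]
  exact Finset.sum_congr rfl fun A _ => by ring

lemma sensorMean_add {n : ℕ} (p : ℝ) {f g : (Fin n → ℝ) → Finset (Fin n) → ℝ}
    (hf : ∀ A, IntegrableOn (f · A) (cube n)) (hg : ∀ A, IntegrableOn (g · A) (cube n)) :
    sensorMean p (fun x A => f x A + g x A) = sensorMean p f + sensorMean p g := by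
  simp only [sensorMean, ← Finset.sum_add_distrib, ← mul_add]
  exact Finset.sum_congr rfl fun A _ => by rw [integral_add (hf A) (hg A)]

lemma sensorMean_sum {n : ℕ} {ι : Type*} (p : ℝ) (s : Finset ι)
    {f : ι → (Fin n → ℝ) → Finset (Fin n) → ℝ}
    (hf : ∀ i ∈ s, ∀ A, IntegrableOn (f i · A) (cube n)) :
    sensorMean p (fun x A => ∑ i ∈ s, f i x A) = ∑ i ∈ s, sensorMean p (f i) := by
  simp only [sensorMean]
  rw [Finset.sum_comm]
  exact Finset.sum_congr rfl fun A _ => by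
    rw [integral_finsetSum _ fun i hi => hf i hi A, Finset.mul_sum]

lemma sensorMean_mono {n : ℕ} {p : ℝ} (hp : p ∈ Set.Ioo (0:ℝ) 1)
    {f g : (Fin n → ℝ) → Finset (Fin n) → ℝ}
    (hf : ∀ A, IntegrableOn (f · A) (cube n)) (hg : ∀ A, IntegrableOn (g · A) (cube n))
    (h : ∀ x ∈ cube n, ∀ A, f x A ≤ g x A) : sensorMean p f ≤ sensorMean p g := by
  refine Finset.sum_le_sum fun A _ => mul_le_mul_of_nonneg_left
    (setIntegral_mono_on (hf A) (hg A) (measurableSet_cube n) fun x hx => h x hx A) ?_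
  have := sub_pos.2 hp.2
  have := hp.1
  unfold prob
  positivity

lemma mul_cost0_le {n : ℕ} (hn : 0 < n) (R : ℕ) {x : Fin n → ℝ} (hx : x ∈ cube n)
    (A : Finset (Fin n)) :
    n * cost0 x A ≤ (R + 1 : ℝ) + ∑ r ∈ Finset.Ico R n, ∑ k ∈ Finset.range (n + 1),
      void (Finset.Ico (k - r) (min n (k + r))) x A := by
  have hn' : (0:ℝ) < n := by exact_mod_cast hn
  set c : ℝ := n * cost0 x A with hc
  have hcn : c ≤ n := mul_le_of_le_one_right hn'.le (cost0_le_one hx A)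
  have inner_nonneg (r : ℕ) : 0 ≤ ∑ k ∈ Finset.range (n + 1),
      void (Finset.Ico (k - r) (min n (k + r))) x A :=
    Finset.sum_nonneg fun _ _ => void_nonneg _ _ _
  have one_le_inner (r : ℕ) (hr : (r:ℝ) + 1 < c) : 1 ≤ ∑ k ∈ Finset.range (n + 1),
      void (Finset.Ico (k - r) (min n (k + r))) x A := by
    obtain ⟨s, hs, hj⟩ := exists_forall_lt_of_lt_cost0
      (show ((r:ℝ) + 1) / n < cost0 x A by rwa [div_lt_iff₀ hn', mul_comm])
    have hks : (⌊(n:ℝ) * s⌋₊ : ℝ) ≤ n * s := Nat.floor_le (mul_nonneg hn'.le hs.1)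
    have hks' : n * s < ⌊(n:ℝ) * s⌋₊ + 1 := Nat.lt_floor_add_one _
    have hkn : ⌊(n:ℝ) * s⌋₊ ∈ Finset.range (n + 1) := by
      rw [Finset.mem_range, Nat.lt_succ_iff]
      exact_mod_cast hks.trans (mul_le_of_le_one_right hn'.le hs.2)
    refine le_trans (le_of_eq ?_)
      (Finset.single_le_sum (fun _ _ => void_nonneg _ _ _) hkn)
    rw [void, if_pos]
    intro j hjA hmem
    rw [Finset.mem_Ico] at hmem
    have hxj := (mem_cube.1 hx j).1
    have h1 : (⌊(n:ℝ) * x j⌋₊ : ℝ) ≤ n * x j := Nat.floor_le (mul_nonneg hn'.le hxj)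
    have h2 : n * x j < ⌊(n:ℝ) * x j⌋₊ + 1 := Nat.lt_floor_add_one _
    have h3 : (⌊(n:ℝ) * s⌋₊ : ℝ) ≤ ⌊(n:ℝ) * x j⌋₊ + r := by
      exact_mod_cast (show ⌊(n:ℝ) * s⌋₊ ≤ ⌊(n:ℝ) * x j⌋₊ + r by omega)
    have h4 : (⌊(n:ℝ) * x j⌋₊ : ℝ) + 1 ≤ ⌊(n:ℝ) * s⌋₊ + r := by
      exact_mod_cast (show ⌊(n:ℝ) * x j⌋₊ + 1 ≤ ⌊(n:ℝ) * s⌋₊ + r by omega)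
    have h5 := hj j hjA
    rw [div_lt_iff₀ hn'] at h5
    have h6 : |s - x j| * n = |n * s - n * x j| := by
      rw [← mul_sub, abs_mul, abs_of_pos hn', mul_comm]
    rw [h6, lt_abs] at h5
    rcases h5 with h5 | h5 <;> linarith
  rcases le_or_gt c (R + 1) with hcR | hcR
  · exact hcR.trans (le_add_of_nonneg_right (Finset.sum_nonneg fun r _ => inner_nonneg r))
  have hm : R + 1 < ⌈c⌉₊ := Nat.lt_ceil.2 (by exact_mod_cast hcR)
  have hmn : ⌈c⌉₊ ≤ n := Nat.ceil_le.2 hcn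
  have hsum : ((⌈c⌉₊ - 1 - R : ℕ) : ℝ) ≤ ∑ r ∈ Finset.Ico R (⌈c⌉₊ - 1),
      ∑ k ∈ Finset.range (n + 1), void (Finset.Ico (k - r) (min n (k + r))) x A := by
    rw [← Nat.card_Ico, ← nsmul_one]
    refine Finset.card_nsmul_le_sum _ _ _ fun r hr => one_le_inner r ?_
    have : r + 1 < ⌈c⌉₊ := by have := Finset.mem_Ico.1 hr; omega
    exact_mod_cast Nat.lt_ceil.1 this
  have hmono := Finset.sum_le_sum_of_subset_of_nonneg
    (Finset.Ico_subset_Ico_right (a := R) (show ⌈c⌉₊ - 1 ≤ n by omega))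
    fun r _ _ => inner_nonneg r
  have hcast : ((⌈c⌉₊ - 1 - R : ℕ) : ℝ) + (R + 1) = ⌈c⌉₊ := by
    exact_mod_cast (show ⌈c⌉₊ - 1 - R + (R + 1) = ⌈c⌉₊ by omega)
  linarith [Nat.le_ceil c]

lemma one_sub_mul_div_nonneg {q : ℝ} (hq : q ∈ Set.Icc (0:ℝ) 1) {c n : ℕ} (hc : c ≤ n) :
    0 ≤ 1 - q * ((c:ℝ) / n) := by
  have h : (c:ℝ) / n ≤ 1 := div_le_one_of_le₀ (by exact_mod_cast hc) (by positivity)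
  linarith [mul_le_one₀ hq.2 (by positivity) h]

lemma one_sub_mul_div_pow_le {q : ℝ} (hq : q ∈ Set.Icc (0:ℝ) 1) {c n : ℕ} (hn : 0 < n)
    (hc : c ≤ n) : (1 - q * ((c:ℝ) / n)) ^ n ≤ Real.exp (-q) ^ c := by
  have hn' : (n:ℝ) ≠ 0 := by positivity
  calc (1 - q * ((c:ℝ) / n)) ^ n ≤ Real.exp (-(q * (c / n))) ^ n :=
        pow_le_pow_left₀ (one_sub_mul_div_nonneg hq hc) (Real.one_sub_le_exp_neg _) n
    _ = Real.exp (-q) ^ c := by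
        rw [← Real.exp_nat_mul, ← Real.exp_nat_mul]
        congr 1
        field_simp

lemma sum_range_pow_le {ρ : ℝ} (h0 : 0 ≤ ρ) (h1 : ρ < 1) (N : ℕ) :
    ∑ i ∈ Finset.range N, ρ ^ i ≤ 1 / (1 - ρ) := by
  rw [Finset.range_eq_Ico]
  simpa only [pow_zero] using geom_sum_Ico_le_of_lt_one (m := 0) (n := N) h0 h1

lemma sum_sum_pow_min_le {ρ : ℝ} (h0 : 0 < ρ) (h1 : ρ < 1) (R n : ℕ) :
    ∑ r ∈ Finset.Ico R n, ∑ k ∈ Finset.range (n + 1), ρ ^ (min k r + min (n - k) r) ≤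
      (n + 1) * ((ρ ^ 2) ^ R / (1 - ρ ^ 2)) + 2 / (1 - ρ) ^ 2 + n * (n + 1) * ρ ^ n := by
  have hpos : 0 < 1 - ρ := sub_pos.2 h1
  have hsq : ρ ^ 2 < 1 := pow_lt_one₀ h0.le h1 two_ne_zero
  have term (r k : ℕ) (hk : k ∈ Finset.range (n + 1)) : ρ ^ (min k r + min (n - k) r) ≤
      (ρ ^ 2) ^ r + ρ ^ r * ρ ^ k + ρ ^ r * ρ ^ (n - k) + ρ ^ n := by
    rw [Finset.mem_range] at hk
    rw [← pow_mul, ← pow_add, ← pow_add]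
    have a1 := pow_pos h0 (2 * r)
    have a2 := pow_pos h0 (r + k)
    have a3 := pow_pos h0 (r + (n - k))
    have a4 := pow_pos h0 n
    rcases le_total k r with h | h <;> rcases le_total (n - k) r with h' | h'
    · rw [min_eq_left h, min_eq_left h', show k + (n - k) = n by omega]; linarith
    · rw [min_eq_left h, min_eq_right h', add_comm k r]; linarith
    · rw [min_eq_right h, min_eq_left h']; linarith
    · rw [min_eq_right h, min_eq_right h', ← two_mul]; linarith
  have inner (r : ℕ) : ∑ k ∈ Finset.range (n + 1), ρ ^ (min k r + min (n - k) r) ≤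
      (n + 1) * (ρ ^ 2) ^ r + 2 / (1 - ρ) * ρ ^ r + (n + 1) * ρ ^ n := by
    refine (Finset.sum_le_sum fun k hk => term r k hk).trans ?_
    have e : ∑ k ∈ Finset.range (n + 1), ρ ^ (n - k) = ∑ k ∈ Finset.range (n + 1), ρ ^ k := by
      simpa using Finset.sum_range_reflect (fun i => ρ ^ i) (n + 1)
    simp only [Finset.sum_add_distrib, ← Finset.mul_sum, e, Finset.sum_const, Finset.card_range,
      nsmul_eq_mul, Nat.cast_add, Nat.cast_one]
    have := mul_le_mul_of_nonneg_left (sum_range_pow_le h0.le h1 (n + 1)) (pow_pos h0 r).le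
    have e2 : 2 / (1 - ρ) * ρ ^ r = ρ ^ r * (1 / (1 - ρ)) + ρ ^ r * (1 / (1 - ρ)) := by ring
    linarith
  refine (Finset.sum_le_sum fun r _ => inner r).trans ?_
  simp only [Finset.sum_add_distrib, ← Finset.mul_sum, Finset.sum_const, Nat.card_Ico,
    nsmul_eq_mul]
  have b1 := geom_sum_Ico_le_of_lt_one (m := R) (n := n) (sq_nonneg ρ) hsq
  have b2 : ∑ i ∈ Finset.Ico R n, ρ ^ i ≤ 1 / (1 - ρ) :=
    (geom_sum_Ico_le_of_lt_one h0.le h1).trans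
      (div_le_div_of_nonneg_right (pow_le_one₀ h0.le h1.le) hpos.le)
  have b3 : ((n - R : ℕ) : ℝ) ≤ n := by exact_mod_cast Nat.sub_le n R
  have e : 2 / (1 - ρ) ^ 2 = 2 / (1 - ρ) * (1 / (1 - ρ)) := by field_simp
  have b4 : ((n:ℝ) + 1) * ((n - R : ℕ) * ρ ^ n) ≤ n * (n + 1) * ρ ^ n := by
    rw [mul_comm (n:ℝ), mul_assoc]
    gcongr
  rw [e]
  exact add_le_add (add_le_add (by gcongr) (by gcongr)) b4

lemma mul_randExp_le {p : ℝ} (hp : p ∈ Set.Ioo (0:ℝ) 1) {n : ℕ} (hn : 0 < n) (R : ℕ) :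
    n * randExp n p ≤ (R + 1) +
      ((n + 1) * ((Real.exp (-(1 - p)) ^ 2) ^ R / (1 - Real.exp (-(1 - p)) ^ 2)) +
        2 / (1 - Real.exp (-(1 - p))) ^ 2 + n * (n + 1) * Real.exp (-(1 - p)) ^ n) := by
  have hq : 1 - p ∈ Set.Icc (0:ℝ) 1 := ⟨by linarith [hp.2], by linarith [hp.1]⟩
  have hρ : Real.exp (-(1 - p)) < 1 := Real.exp_lt_one_iff.2 (by linarith [hp.2])
  have hint (r : ℕ) (A : Finset (Fin n)) : IntegrableOn (fun x => ∑ k ∈ Finset.range (n + 1),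
      void (Finset.Ico (k - r) (min n (k + r))) x A) (cube n) :=
    integrable_finsetSum _ fun _ _ => integrableOn_void _ A
  have hint' (A : Finset (Fin n)) : IntegrableOn (fun x => ∑ r ∈ Finset.Ico R n,
      ∑ k ∈ Finset.range (n + 1), void (Finset.Ico (k - r) (min n (k + r))) x A) (cube n) :=
    integrable_finsetSum _ fun r _ => hint r A
  rw [randExp_eq_sensorMean, ← sensorMean_mul_left]
  refine (sensorMean_mono hp (g := fun x A => ((R:ℝ) + 1) + ∑ r ∈ Finset.Ico R n,
      ∑ k ∈ Finset.range (n + 1), void (Finset.Ico (k - r) (min n (k + r))) x A)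
    (fun A => (integrableOn_cost0 A).const_mul _)
    (fun A => (integrable_const ((R:ℝ) + 1)).add (hint' A))
    fun x hx A => mul_cost0_le hn R hx A).trans ?_
  rw [sensorMean_add p (fun A => integrable_const _) hint', sensorMean_const,
    sensorMean_sum p _ fun r _ A => hint r A]
  gcongr
  refine le_trans (Finset.sum_le_sum fun r _ => ?_)
    (sum_sum_pow_min_le (Real.exp_pos (-(1 - p))) hρ R n)
  rw [sensorMean_sum p _ fun k _ A => integrableOn_void _ A]
  refine Finset.sum_le_sum fun k hk => ?_
  rw [Finset.mem_range] at hk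
  have hsub : Finset.Ico (k - r) (min n (k + r)) ⊆ Finset.range n := fun i hi => by
    simp only [Finset.mem_Ico, Finset.mem_range] at *; omega
  have hcard : #(Finset.Ico (k - r) (min n (k + r))) = min k r + min (n - k) r := by
    rw [Nat.card_Ico]; omega
  rw [sensorMean_void p hsub, hcard]
  exact one_sub_mul_div_pow_le hq hn (by omega)

lemma sum_range_pow_dist_le {ρ : ℝ} (h0 : 0 < ρ) (h1 : ρ < 1) {k N : ℕ} (hk : k ≤ N) :
    ∑ l ∈ Finset.range N, ρ ^ (k - l + (l - k)) ≤ 2 / (1 - ρ) := by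
  rw [← Finset.sum_range_add_sum_Ico _ hk, Finset.sum_Ico_eq_sum_range]
  have a1 : ∑ l ∈ Finset.range k, ρ ^ (k - l + (l - k)) ≤ 1 / (1 - ρ) := by
    refine le_trans ?_ (sum_range_pow_le h0.le h1 k)
    rw [← Finset.sum_range_reflect]
    exact Finset.sum_le_sum fun l hl => pow_le_pow_of_le_one h0.le h1.le (by
      rw [Finset.mem_range] at hl; omega)
  have a2 : ∑ i ∈ Finset.range (N - k), ρ ^ (k - (k + i) + (k + i - k)) ≤ 1 / (1 - ρ) := by
    refine le_trans (le_of_eq (Finset.sum_congr rfl fun i _ => ?_))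
      (sum_range_pow_le h0.le h1 (N - k))
    congr 1
    omega
  have e : 2 / (1 - ρ) = 1 / (1 - ρ) + 1 / (1 - ρ) := by ring
  linarith

/-- Number of grid points `k/n` with `U ≤ k ≤ n - U` such that no active
sensor lies in `[(k-u)/n, (k+u)/n)`. -/
noncomputable def voidCount {n : ℕ} (U u : ℕ) (x : Fin n → ℝ) (A : Finset (Fin n)) : ℝ :=
  ∑ k ∈ Finset.Icc U (n - U), void (Finset.Ico (k - u) (k + u)) x A

lemma le_mul_cost0_of_voidCount_ne_zero {n U u : ℕ} (hn : 0 < n) (hu : u ≤ U) (hU : U ≤ n)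
    {x : Fin n → ℝ} (hx : x ∈ cube n) {A : Finset (Fin n)} (h : voidCount U u x A ≠ 0) :
    (u:ℝ) ≤ n * cost0 x A := by
  have hn' : (0:ℝ) < n := by exact_mod_cast hn
  obtain ⟨k, hk, hv⟩ := Finset.exists_ne_zero_of_sum_ne_zero h
  have hvoid : ∀ j ∈ A, ⌊(n:ℝ) * x j⌋₊ ∉ Finset.Ico (k - u) (k + u) := by
    by_contra hcon
    exact hv (if_neg hcon)
  rw [Finset.mem_Icc] at hk
  have hkn : (k:ℝ) ≤ n := by exact_mod_cast hk.2.trans (Nat.sub_le n U)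
  have hun : (u:ℝ) ≤ n := by exact_mod_cast hu.trans hU
  rw [mul_comm, ← div_le_iff₀ hn']
  refine le_cost0 (s := (k:ℝ) / n) ((div_le_one hn').2 hun)
    ⟨by positivity, (div_le_one hn').2 hkn⟩ fun j hj => ?_
  have h6 : |(k:ℝ) / n - x j| * n = |k - n * x j| := by
    rw [← abs_of_pos hn', ← abs_mul, abs_of_pos hn', sub_mul, div_mul_cancel₀ _ hn'.ne',
      mul_comm (x j)]
  rw [div_le_iff₀ hn', h6, le_abs]
  have hxj := (mem_cube.1 hx j).1
  have h1 : (⌊(n:ℝ) * x j⌋₊ : ℝ) ≤ n * x j := Nat.floor_le (mul_nonneg hn'.le hxj)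
  have h2 : n * x j < ⌊(n:ℝ) * x j⌋₊ + 1 := Nat.lt_floor_add_one _
  have h3 := hvoid j hj
  rw [Finset.mem_Ico, not_and_or, not_le, not_lt] at h3
  rcases h3 with h3 | h3
  · have : (⌊(n:ℝ) * x j⌋₊ : ℝ) + 1 + u ≤ k := by
      exact_mod_cast (show ⌊(n:ℝ) * x j⌋₊ + 1 + u ≤ k by omega)
    left; linarith
  · have : (k:ℝ) + u ≤ ⌊(n:ℝ) * x j⌋₊ := by exact_mod_cast h3
    right; linarith

lemma sum_le_mul_cost0 {n U : ℕ} (hn : 0 < n) (hU : U ≤ n) {a : ℕ → ℝ} (ha : ∀ u, a u ≠ 0)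
    {x : Fin n → ℝ} (hx : x ∈ cube n) (A : Finset (Fin n)) :
    ∑ u ∈ Finset.Ioc 0 U, (1 + -((a u ^ 2)⁻¹) * (voidCount U u x A - a u) ^ 2) ≤
      n * cost0 x A := by
  have hc : 0 ≤ n * cost0 x A := mul_nonneg (Nat.cast_nonneg n) (cost0_nonneg x A)
  calc _ ≤ ∑ u ∈ Finset.Ioc 0 U, if (u:ℝ) ≤ n * cost0 x A then (1:ℝ) else 0 := by
        refine Finset.sum_le_sum fun u hu => ?_
        rw [Finset.mem_Ioc] at hu
        split_ifs with h
        · have : 0 ≤ (a u ^ 2)⁻¹ * (voidCount U u x A - a u) ^ 2 := by positivity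
          linarith
        · have hz : voidCount U u x A = 0 := by
            by_contra hne
            exact h (le_mul_cost0_of_voidCount_ne_zero hn hu.2 hU hx hne)
          have := ha u
          rw [hz, zero_sub, neg_sq, neg_mul, inv_mul_cancel₀ (pow_ne_zero 2 this)]
          norm_num
    _ ≤ (⌊n * cost0 x A⌋₊ : ℝ) := by
        rw [Finset.sum_boole]
        have hsub : {u ∈ Finset.Ioc 0 U | ((u:ℕ):ℝ) ≤ n * cost0 x A} ⊆
            Finset.Ioc 0 ⌊n * cost0 x A⌋₊ := fun u hu => by
          simp only [Finset.mem_filter, Finset.mem_Ioc] at hu ⊢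
          exact ⟨hu.1.1, Nat.le_floor hu.2⟩
        have := Finset.card_le_card hsub
        rw [Nat.card_Ioc, Nat.sub_zero] at this
        exact_mod_cast this
    _ ≤ n * cost0 x A := Nat.floor_le hc

lemma card_Ico_union_Ico {k l u : ℕ} (hk : u ≤ k) (hl : u ≤ l) :
    #(Finset.Ico (k - u) (k + u) ∪ Finset.Ico (l - u) (l + u)) =
      2 * u + min (k - l + (l - k)) (2 * u) := by
  have h := Finset.card_union_add_card_inter (Finset.Ico (k - u) (k + u))
    (Finset.Ico (l - u) (l + u))
  rw [Finset.Ico_inter_Ico] at h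
  simp only [Nat.card_Ico] at h
  omega

lemma sensorMean_void_union_le {p : ℝ} (hp : p ∈ Set.Ioo (0:ℝ) 1) {n k l u : ℕ} (hn : 0 < n)
    (hk : u ≤ k) (hl : u ≤ l) (hk' : k + u ≤ n) (hl' : l + u ≤ n) (hu : 4 * u ≤ n) :
    sensorMean p (void (n := n) (Finset.Ico (k - u) (k + u) ∪ Finset.Ico (l - u) (l + u))) ≤
      (1 - (1 - p) * ((2 * u : ℕ) / n)) ^ n * ((1 - (1 - p) * ((2 * u : ℕ) / n)) ^ n +
        Real.exp (-(1 - p)) ^ (k - l + (l - k))) := by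
  have hq : 1 - p ∈ Set.Icc (0:ℝ) 1 := ⟨by linarith [hp.2], by linarith [hp.1]⟩
  have hsub : Finset.Ico (k - u) (k + u) ∪ Finset.Ico (l - u) (l + u) ⊆ Finset.range n :=
    fun i hi => by
      simp only [Finset.mem_union, Finset.mem_Ico, Finset.mem_range] at *; omega
  rw [sensorMean_void p hsub, card_Ico_union_Ico hk hl]
  set e := min (k - l + (l - k)) (2 * u) with he
  have hw : 0 ≤ 1 - (1 - p) * (((2 * u : ℕ) : ℝ) / n) := one_sub_mul_div_nonneg hq (by omega)
  have hsplit : (1 - (1 - p) * (((2 * u + e : ℕ) : ℝ) / n)) ^ n ≤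
      (1 - (1 - p) * (((2 * u : ℕ) : ℝ) / n)) ^ n * (1 - (1 - p) * ((e : ℝ) / n)) ^ n := by
    rw [← mul_pow]
    refine pow_le_pow_left₀ (one_sub_mul_div_nonneg hq (by omega)) ?_ n
    have h1 : 0 ≤ (1 - p) * (((2 * u : ℕ) : ℝ) / n) * ((1 - p) * ((e : ℝ) / n)) := by
      have := hq.1
      positivity
    have h2 : (1 - p) * (((2 * u + e : ℕ) : ℝ) / n) =
        (1 - p) * (((2 * u : ℕ) : ℝ) / n) + (1 - p) * ((e : ℝ) / n) := by
      push_cast; ring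
    linarith
  refine hsplit.trans (mul_le_mul_of_nonneg_left ?_ (pow_nonneg hw n))
  rcases min_choice (k - l + (l - k)) (2 * u) with h | h
  · have := one_sub_mul_div_pow_le hq hn (show e ≤ n by omega)
    rw [he, h] at this ⊢
    linarith [pow_nonneg hw n]
  · rw [he, h]
    exact le_add_of_nonneg_right (by positivity)

lemma integrableOn_voidCount {n : ℕ} (U u : ℕ) (A : Finset (Fin n)) :
    IntegrableOn (fun x => voidCount U u x A) (cube n) :=
  integrable_finsetSum _ fun _ _ => integrableOn_void _ A

lemma voidCount_sq {n : ℕ} (U u : ℕ) (x : Fin n → ℝ) (A : Finset (Fin n)) :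
    voidCount U u x A ^ 2 = ∑ k ∈ Finset.Icc U (n - U), ∑ l ∈ Finset.Icc U (n - U),
      void (Finset.Ico (k - u) (k + u) ∪ Finset.Ico (l - u) (l + u)) x A := by
  simp only [voidCount, sq, Finset.sum_mul_sum, void_mul_void]

lemma integrableOn_voidCount_sq {n : ℕ} (U u : ℕ) (A : Finset (Fin n)) :
    IntegrableOn (fun x => voidCount U u x A ^ 2) (cube n) := by
  simp only [voidCount_sq]
  exact integrable_finsetSum _ fun _ _ => integrable_finsetSum _ fun _ _ => integrableOn_void _ A

lemma sensorMean_voidCount (p : ℝ) {n U u : ℕ} (hu : u ≤ U) (hU : U ≤ n) :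
    sensorMean p (voidCount (n := n) U u) =
      #(Finset.Icc U (n - U)) * (1 - (1 - p) * ((2 * u : ℕ) / n)) ^ n := by
  unfold voidCount
  rw [sensorMean_sum p _ fun k _ A => integrableOn_void _ A, ← nsmul_eq_mul]
  refine Finset.sum_eq_card_nsmul fun k hk => ?_
  rw [Finset.mem_Icc] at hk
  have hsub : Finset.Ico (k - u) (k + u) ⊆ Finset.range n := fun i hi => by
    simp only [Finset.mem_Ico, Finset.mem_range] at *; omega
  rw [sensorMean_void p hsub, Nat.card_Ico, show k + u - (k - u) = 2 * u by omega]

lemma sensorMean_voidCount_sq_le {p : ℝ} (hp : p ∈ Set.Ioo (0:ℝ) 1) {n U u : ℕ} (hn : 0 < n)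
    (hu : u ≤ U) (hU : 4 * U ≤ n) :
    sensorMean p (fun x A => voidCount (n := n) U u x A ^ 2) ≤
      sensorMean p (voidCount (n := n) U u) ^ 2 +
        sensorMean p (voidCount (n := n) U u) * (2 / (1 - Real.exp (-(1 - p)))) := by
  have hq : 1 - p ∈ Set.Icc (0:ℝ) 1 := ⟨by linarith [hp.2], by linarith [hp.1]⟩
  have hρ : Real.exp (-(1 - p)) < 1 := Real.exp_lt_one_iff.2 (by linarith [hp.2])
  simp only [voidCount_sq]
  rw [sensorMean_voidCount p hu (by omega), sensorMean_sum p _ fun k _ A =>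
    integrable_finsetSum _ fun _ _ => integrableOn_void _ A]
  set w := (1 - (1 - p) * (((2 * u : ℕ) : ℝ) / n)) ^ n with hw
  have hw0 : 0 ≤ w := pow_nonneg (one_sub_mul_div_nonneg hq (by omega)) n
  set K := Finset.Icc U (n - U) with hK
  have inner : ∀ k ∈ K, sensorMean p (fun (x : Fin n → ℝ) A => ∑ l ∈ K,
      void (Finset.Ico (k - u) (k + u) ∪ Finset.Ico (l - u) (l + u)) x A) ≤
      w * (#K * w + 2 / (1 - Real.exp (-(1 - p)))) := fun k hk => by
    rw [hK, Finset.mem_Icc] at hk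
    rw [sensorMean_sum p _ fun _ _ A => integrableOn_void _ A]
    calc _ ≤ ∑ l ∈ K, w * (w + Real.exp (-(1 - p)) ^ (k - l + (l - k))) := by
          refine Finset.sum_le_sum fun l hl => ?_
          rw [hK, Finset.mem_Icc] at hl
          exact sensorMean_void_union_le hp hn (by omega) (by omega) (by omega) (by omega)
            (by omega)
      _ = w * (#K * w + ∑ l ∈ K, Real.exp (-(1 - p)) ^ (k - l + (l - k))) := by
          rw [← Finset.mul_sum, Finset.sum_add_distrib, Finset.sum_const, nsmul_eq_mul]
      _ ≤ _ := by
          gcongr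
          refine le_trans (Finset.sum_le_sum_of_subset_of_nonneg (t := Finset.range (n + 1))
            (fun l hl => ?_) fun l _ _ => by positivity)
            (sum_range_pow_dist_le (Real.exp_pos _) hρ (by omega))
          rw [hK, Finset.mem_Icc] at hl
          rw [Finset.mem_range]
          omega
  refine (Finset.sum_le_card_nsmul _ _ _ inner).trans (le_of_eq ?_)
  rw [nsmul_eq_mul]
  ring

lemma sensorMean_voidCount_sub_sq_le {p : ℝ} (hp : p ∈ Set.Ioo (0:ℝ) 1) {n U u : ℕ} (hn : 0 < n)
    (hu : u ≤ U) (hU : 4 * U ≤ n) :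
    sensorMean p (fun x A => (voidCount (n := n) U u x A -
        sensorMean p (voidCount (n := n) U u)) ^ 2) ≤
      sensorMean p (voidCount (n := n) U u) * (2 / (1 - Real.exp (-(1 - p)))) := by
  have h := sensorMean_voidCount_sq_le hp hn hu hU
  set a := sensorMean p (voidCount (n := n) U u) with ha
  have e (x : Fin n → ℝ) (A : Finset (Fin n)) : (voidCount U u x A - a) ^ 2 =
      voidCount U u x A ^ 2 + ((-2 * a) * voidCount U u x A + a ^ 2) := by ring
  have hint (A : Finset (Fin n)) :
      IntegrableOn (fun x => (-2 * a) * voidCount U u x A + a ^ 2) (cube n) :=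
    ((integrableOn_voidCount U u A).const_mul _).add (integrable_const _)
  simp only [e]
  rw [sensorMean_add p (integrableOn_voidCount_sq U u) hint,
    sensorMean_add p (fun A => (integrableOn_voidCount U u A).const_mul _)
      fun A => integrable_const _, sensorMean_mul_left, sensorMean_const, ← ha]
  linarith

lemma le_mul_randExp {p : ℝ} (hp : p ∈ Set.Ioo (0:ℝ) 1) {n U : ℕ} (hn : 0 < n)
    (hU : 4 * U ≤ n) {b : ℕ → ℝ} (hb : ∀ u, 0 < b u)
    (hab : ∀ u ≤ U, b u ≤ sensorMean p (voidCount (n := n) U u)) :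
    U - 2 / (1 - Real.exp (-(1 - p))) * ∑ u ∈ Finset.Ioc 0 U, (b u)⁻¹ ≤ n * randExp n p := by
  have hρ : Real.exp (-(1 - p)) < 1 := Real.exp_lt_one_iff.2 (by linarith [hp.2])
  have hρ' := sub_pos.2 hρ
  let a : ℕ → ℝ := fun u => if u ≤ U then sensorMean p (voidCount (n := n) U u) else 1
  have ha (u : ℕ) : a u ≠ 0 := by
    simp only [a]
    split_ifs with h
    · exact ((hb u).trans_le (hab u h)).ne'
    · exact one_ne_zero
  have hint (u : ℕ) (A : Finset (Fin n)) :
      IntegrableOn (fun x => (voidCount U u x A - a u) ^ 2) (cube n) := by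
    have e (x : Fin n → ℝ) : (voidCount U u x A - a u) ^ 2 =
        voidCount U u x A ^ 2 + ((-2 * a u) * voidCount U u x A + a u ^ 2) := by ring
    simp only [e]
    exact (integrableOn_voidCount_sq U u A).add
      (((integrableOn_voidCount U u A).const_mul _).add (integrable_const _))
  have hint' (u : ℕ) (A : Finset (Fin n)) : IntegrableOn
      (fun x => 1 + -((a u ^ 2)⁻¹) * (voidCount U u x A - a u) ^ 2) (cube n) :=
    (integrable_const _).add ((hint u A).const_mul _)
  rw [randExp_eq_sensorMean, ← sensorMean_mul_left]
  refine le_trans ?_ (sensorMean_mono hp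
    (fun A => integrable_finsetSum (Finset.Ioc 0 U) fun u _ => hint' u A)
    (fun A => (integrableOn_cost0 A).const_mul _)
    fun x hx A => sum_le_mul_cost0 hn (by omega) ha hx A)
  rw [sensorMean_sum p _ fun u _ A => hint' u A]
  have hcard : (U:ℝ) = ∑ u ∈ Finset.Ioc 0 U, (1:ℝ) := by simp
  rw [Finset.mul_sum, hcard, ← Finset.sum_sub_distrib]
  refine Finset.sum_le_sum fun u hu => ?_
  rw [Finset.mem_Ioc] at hu
  rw [sensorMean_add p (fun A => integrable_const _) (fun A => (hint u A).const_mul _),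
    sensorMean_const, sensorMean_mul_left]
  have hau : a u = sensorMean p (voidCount (n := n) U u) := if_pos hu.2
  have hvar := sensorMean_voidCount_sub_sq_le hp hn hu.2 hU
  have hba := hab u hu.2
  rw [← hau] at hvar hba
  have hbu := hb u
  have hapos : 0 < a u := hbu.trans_le hba
  have h1 : (a u ^ 2)⁻¹ * sensorMean p (fun x A => (voidCount (n := n) U u x A - a u) ^ 2) ≤
      2 / (1 - Real.exp (-(1 - p))) * (b u)⁻¹ := by
    calc _ ≤ (a u ^ 2)⁻¹ * (a u * (2 / (1 - Real.exp (-(1 - p))))) := by gcongr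
      _ = 2 / (1 - Real.exp (-(1 - p))) * (a u)⁻¹ := by field_simp
      _ ≤ _ := by gcongr
  linarith

lemma exp_le_one_sub_div_pow {n : ℕ} (hn : 0 < n) {y : ℝ} (hy : 0 ≤ y) (hyn : y ≤ n / 2)
    (hsq : y ^ 2 ≤ n) : Real.exp (-2) * Real.exp (-y) ≤ (1 - y / n) ^ n := by
  have hn' : (0:ℝ) < n := by exact_mod_cast hn
  set t := y / n with ht
  have hy' : y = n * t := by rw [ht]; field_simp
  have ht0 : 0 ≤ t := by positivity
  have ht1 : t ≤ 1 / 2 := by rw [ht, div_le_iff₀ hn']; linarith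
  have key : Real.exp (-(t + 2 * t ^ 2)) ≤ 1 - t := by
    rw [Real.exp_neg, inv_le_comm₀ (Real.exp_pos _) (by linarith)]
    refine le_trans ?_ (Real.add_one_le_exp _)
    rw [inv_le_iff_one_le_mul₀ (by linarith)]
    nlinarith [mul_nonneg (sq_nonneg t) (show 0 ≤ 1 - 2 * t by linarith)]
  calc Real.exp (-2) * Real.exp (-y) ≤ Real.exp (-(t + 2 * t ^ 2)) ^ n := by
        rw [← Real.exp_add, ← Real.exp_nat_mul, Real.exp_le_exp, hy']
        have : n * t ^ 2 ≤ 1 := by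
          rw [hy', mul_pow, sq (n:ℝ), mul_assoc] at hsq
          exact le_of_mul_le_mul_left (by linarith) hn'
        linarith
    _ ≤ (1 - t) ^ n := pow_le_pow_left₀ (Real.exp_pos _).le key n

lemma eventually_log_le_mul {c : ℝ} (hc : 0 < c) :
    ∀ᶠ n : ℕ in Filter.atTop, Real.log n ≤ c * n := by
  have h := (Real.isLittleO_log_id_atTop.comp_tendsto tendsto_natCast_atTop_atTop).bound hc
  filter_upwards [h] with n hn
  simpa using (le_abs_self _).trans hn

lemma eventually_log_sq_le : ∀ᶠ n : ℕ in Filter.atTop, Real.log n ^ 2 ≤ n := by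
  have h := ((Real.isLittleO_pow_log_id_atTop (n := 2)).comp_tendsto
    tendsto_natCast_atTop_atTop).bound one_pos
  filter_upwards [h] with n hn
  simpa using (le_abs_self _).trans hn

lemma eventually_mul_succ_mul_pow_le_one {ρ : ℝ} (h0 : 0 < ρ) (h1 : ρ < 1) :
    ∀ᶠ n : ℕ in Filter.atTop, n * (n + 1) * ρ ^ n ≤ 1 := by
  have h (k : ℕ) := tendsto_pow_const_mul_const_pow_of_abs_lt_one k
    (show |ρ| < 1 by rwa [abs_of_pos h0])
  have hsum := (h 2).add (h 1)
  rw [add_zero] at hsum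
  filter_upwards [hsum.eventually_le_const one_pos] with n hn
  linarith

lemma mul_randExp_le_log {p : ℝ} (hp : p ∈ Set.Ioo (0:ℝ) 1) {n : ℕ} (hn : 0 < n)
    (hgeom : n * (n + 1) * Real.exp (-(1 - p)) ^ n ≤ 1) :
    n * randExp n p ≤ Real.log n / (2 * (1 - p)) +
      (3 + 2 / (1 - Real.exp (-(1 - p)) ^ 2) + 2 / (1 - Real.exp (-(1 - p))) ^ 2) := by
  have hq : 0 < 1 - p := sub_pos.2 hp.2
  have hρ1 : Real.exp (-(1 - p)) < 1 := Real.exp_lt_one_iff.2 (by linarith)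
  have hρsq : 0 < 1 - Real.exp (-(1 - p)) ^ 2 :=
    sub_pos.2 (pow_lt_one₀ (Real.exp_pos _).le hρ1 two_ne_zero)
  have hn1 : (1:ℝ) ≤ n := by exact_mod_cast hn
  have hlog : 0 ≤ Real.log n / (2 * (1 - p)) := div_nonneg (Real.log_nonneg hn1) (by linarith)
  have h := mul_randExp_le hp hn ⌈Real.log n / (2 * (1 - p))⌉₊
  have hR := Nat.ceil_lt_add_one hlog
  have hR' := Nat.le_ceil (Real.log n / (2 * (1 - p)))
  set R := ⌈Real.log n / (2 * (1 - p))⌉₊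
  have hpow : (Real.exp (-(1 - p)) ^ 2) ^ R ≤ (n:ℝ)⁻¹ := by
    rw [← pow_mul, ← Real.exp_nat_mul, ← Real.exp_log (show (0:ℝ) < n by linarith),
      ← Real.exp_neg, Real.exp_le_exp]
    rw [div_le_iff₀ (by linarith)] at hR'
    push_cast
    linarith
  have hterm : ((n:ℝ) + 1) * ((Real.exp (-(1 - p)) ^ 2) ^ R / (1 - Real.exp (-(1 - p)) ^ 2)) ≤
      2 / (1 - Real.exp (-(1 - p)) ^ 2) := by
    rw [← mul_div_assoc]
    gcongr
    calc ((n:ℝ) + 1) * (Real.exp (-(1 - p)) ^ 2) ^ R ≤ (n + n) * (n:ℝ)⁻¹ := by gcongr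
      _ = 2 := by field_simp; norm_num
  linarith

lemma sum_exp_le {q : ℝ} (hq : 0 < q) (U : ℕ) :
    ∑ u ∈ Finset.Ioc 0 U, Real.exp (2 * q * u) ≤
      Real.exp (2 * q * U) / (1 - Real.exp (-q) ^ 2) := by
  have hρ1 : Real.exp (-q) < 1 := Real.exp_lt_one_iff.2 (by linarith)
  have hsq : Real.exp (-q) ^ 2 < 1 := pow_lt_one₀ (Real.exp_pos _).le hρ1 two_ne_zero
  calc ∑ u ∈ Finset.Ioc 0 U, Real.exp (2 * q * u)
      = ∑ u ∈ Finset.Ioc 0 U, Real.exp (2 * q * U) * (Real.exp (-q) ^ 2) ^ (U - u) := by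
        refine Finset.sum_congr rfl fun u hu => ?_
        rw [← pow_mul, ← Real.exp_nat_mul, ← Real.exp_add]
        push_cast [Nat.cast_sub (Finset.mem_Ioc.1 hu).2]
        ring_nf
    _ ≤ ∑ u ∈ Finset.range (U + 1), Real.exp (2 * q * U) * (Real.exp (-q) ^ 2) ^ (U - u) := by
        refine Finset.sum_le_sum_of_subset_of_nonneg (fun u hu => ?_) fun _ _ _ => by positivity
        rw [Finset.mem_Ioc] at hu
        rw [Finset.mem_range]
        omega
    _ = Real.exp (2 * q * U) * ∑ u ∈ Finset.range (U + 1), (Real.exp (-q) ^ 2) ^ u := by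
        rw [← Finset.mul_sum]
        congr 1
        simpa using Finset.sum_range_reflect (fun i => (Real.exp (-q) ^ 2) ^ i) (U + 1)
    _ ≤ _ := by
        rw [div_eq_mul_one_div]
        gcongr
        exact sum_range_pow_le (sq_nonneg _) hsq _

lemma log_le_mul_randExp {p : ℝ} (hp : p ∈ Set.Ioo (0:ℝ) 1) {n : ℕ} (hn : 0 < n)
    (hlog : Real.log n ≤ (1 - p) / 2 * n) (hlogsq : Real.log n ^ 2 ≤ n) :
    Real.log n / (2 * (1 - p)) - (1 + 2 / (1 - Real.exp (-(1 - p))) *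
      (2 * Real.exp 2 / (1 - Real.exp (-(1 - p)) ^ 2))) ≤ n * randExp n p := by
  have hq : 0 < 1 - p := sub_pos.2 hp.2
  have hρ1 : Real.exp (-(1 - p)) < 1 := Real.exp_lt_one_iff.2 (by linarith)
  have hρ' : 0 < 1 - Real.exp (-(1 - p)) := sub_pos.2 hρ1
  have hρsq : 0 < 1 - Real.exp (-(1 - p)) ^ 2 :=
    sub_pos.2 (pow_lt_one₀ (Real.exp_pos _).le hρ1 two_ne_zero)
  have hn' : (0:ℝ) < n := by exact_mod_cast hn
  have hlog0 : 0 ≤ Real.log n := Real.log_nonneg (by exact_mod_cast hn)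
  have hUle := Nat.floor_le (show 0 ≤ Real.log n / (2 * (1 - p)) by positivity)
  have hUlt := Nat.lt_floor_add_one (Real.log n / (2 * (1 - p)))
  set U := ⌊Real.log n / (2 * (1 - p))⌋₊
  have hUlog : 2 * (1 - p) * U ≤ Real.log n := by
    rw [le_div_iff₀ (by linarith)] at hUle
    linarith
  have hU : 4 * U ≤ n := by
    have : (1 - p) * (4 * U : ℝ) ≤ (1 - p) * n := by linarith
    exact_mod_cast le_of_mul_le_mul_left this hq
  have hcard : (n:ℝ) / 2 ≤ #(Finset.Icc U (n - U)) := by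
    rw [Nat.card_Icc, div_le_iff₀ two_pos]
    exact_mod_cast (show n ≤ (n - U + 1 - U) * 2 by omega)
  have hb (u : ℕ) (hu : u ≤ U) : (n:ℝ) / 2 * (Real.exp (-2) * Real.exp (-(2 * (1 - p) * u))) ≤
      sensorMean p (voidCount (n := n) U u) := by
    rw [sensorMean_voidCount p hu (by omega)]
    have huU : (u:ℝ) ≤ U := by exact_mod_cast hu
    have hyU : 2 * (1 - p) * u ≤ Real.log n := le_trans (by gcongr) hUlog
    have hy0 : 0 ≤ 2 * (1 - p) * u := by positivity
    have hbase := exp_le_one_sub_div_pow hn hy0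
      (by nlinarith [hp.1]) ((pow_le_pow_left₀ hy0 hyU 2).trans hlogsq)
    have e : (1 - p) * (((2 * u : ℕ) : ℝ) / n) = 2 * (1 - p) * u / n := by push_cast; ring
    rw [e]
    gcongr
  have h := le_mul_randExp hp hn hU (fun u => by positivity) hb
  have hsum : ∑ u ∈ Finset.Ioc 0 U,
      ((n:ℝ) / 2 * (Real.exp (-2) * Real.exp (-(2 * (1 - p) * u))))⁻¹ ≤
      2 * Real.exp 2 / (1 - Real.exp (-(1 - p)) ^ 2) := by
    calc _ = 2 * Real.exp 2 / n * ∑ u ∈ Finset.Ioc 0 U, Real.exp (2 * (1 - p) * u) := by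
          rw [Finset.mul_sum]
          refine Finset.sum_congr rfl fun u _ => ?_
          rw [Real.exp_neg, Real.exp_neg]
          field_simp
      _ ≤ 2 * Real.exp 2 / n * (n / (1 - Real.exp (-(1 - p)) ^ 2)) := by
          refine mul_le_mul_of_nonneg_left ((sum_exp_le hq U).trans ?_) (by positivity)
          gcongr
          calc Real.exp (2 * (1 - p) * U) ≤ Real.exp (Real.log n) := Real.exp_le_exp.2 hUlog
            _ = n := Real.exp_log hn'
      _ = _ := by field_simp
  have := mul_le_mul_of_nonneg_left hsum (show 0 ≤ 2 / (1 - Real.exp (-(1 - p))) by positivity)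
  linarith

/-- `E[C(x^rand)] = (1/(2(1-p))) (log n)/n + O(1/n)` as
`n → ∞`. -/
theorem randExp_asymptotic (p : ℝ) (hp : p ∈ Set.Ioo (0:ℝ) 1) :
    ∃ M : ℝ, 0 < M ∧ ∃ n0 : ℕ, ∀ n : ℕ, n0 ≤ n →
      |randExp n p - 1 / (2 * (1 - p)) * (Real.log n / n)| ≤ M / n := by
  have hq : 0 < 1 - p := sub_pos.2 hp.2
  have hρ0 := Real.exp_pos (-(1 - p))
  have hρ1 : Real.exp (-(1 - p)) < 1 := Real.exp_lt_one_iff.2 (by linarith)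
  set ρ := Real.exp (-(1 - p)) with hρ
  have hρ' : 0 < 1 - ρ := sub_pos.2 hρ1
  have hρsq : 0 < 1 - ρ ^ 2 := sub_pos.2 (pow_lt_one₀ hρ0.le hρ1 two_ne_zero)
  set Mu : ℝ := 3 + 2 / (1 - ρ ^ 2) + 2 / (1 - ρ) ^ 2 with hMu
  set Ml : ℝ := 1 + 2 / (1 - ρ) * (2 * Real.exp 2 / (1 - ρ ^ 2)) with hMl
  have hMu0 : 0 < Mu := by positivity
  have hMl0 : 0 < Ml := by positivity
  obtain ⟨n0, hn0⟩ := Filter.eventually_atTop.1 ((Filter.eventually_gt_atTop 0).and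
    ((eventually_log_le_mul (show 0 < (1 - p) / 2 by positivity)).and
      (eventually_log_sq_le.and (eventually_mul_succ_mul_pow_le_one hρ0 hρ1))))
  refine ⟨Mu + Ml, by positivity, n0, fun n hn => ?_⟩
  obtain ⟨hnpos, hlog, hlogsq, hgeom⟩ := hn0 n hn
  have hn' : (0:ℝ) < n := by exact_mod_cast hnpos
  have hupper : n * randExp n p ≤ Real.log n / (2 * (1 - p)) + Mu :=
    mul_randExp_le_log hp hnpos hgeom
  have hlower : Real.log n / (2 * (1 - p)) - Ml ≤ n * randExp n p :=
    log_le_mul_randExp hp hnpos hlog hlogsq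
  have e : randExp n p - 1 / (2 * (1 - p)) * (Real.log n / n) =
      (n * randExp n p - Real.log n / (2 * (1 - p))) / n := by
    field_simp
  rw [e, abs_div, abs_of_pos hn']
  gcongr
  rw [abs_le]
  constructor <;> linarith
end
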